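/- Let {x_k}_{k=1}^m be a frame for ℂⁿ. The following are equivalent: (1) {x_k}_{k=1}^m is injective; (2) the family {x̃_k}_{k=1}^m spans ℝ^{n²}. -/

import Mathlib

open scoped InnerProductSpace ComplexConjugate

/-- For `x ∈ ℂⁿ`, the vector `x̃ ∈ ℝ^{n²}`, whose entries are `|x_i|²` for each `i`,
together with `Re(x̄_i x_j)` and `Im(x̄_i x_j)` for `i < j`
(`Bool` value `false` picks the real part, `true` the imaginary part). -/
noncomputable def tildeVecC {n : ℕ} (x : EuclideanSpace ℂ (Fin n)) :
    (Fin n ⊕ ({p : Fin n × Fin n // p.1 < p.2} × Bool)) → ℝ :=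
  Sum.elim (fun i => ‖x i‖ ^ 2)
    (fun q => if q.2 then (conj (x q.1.1.1) * x q.1.1.2).im
      else (conj (x q.1.1.1) * x q.1.1.2).re)

lemma exL {n : ℕ} (i j : Fin n) :
    ∃ L : ((Fin n ⊕ ({p : Fin n × Fin n // p.1 < p.2} × Bool)) → ℝ) →ₗ[ℝ] ℂ,
      ∀ v : EuclideanSpace ℂ (Fin n), L (tildeVecC v) = conj (v i) * v j := by
  let R : (Fin n ⊕ ({p : Fin n × Fin n // p.1 < p.2} × Bool)) → ℂ →
    (((Fin n ⊕ ({p : Fin n × Fin n // p.1 < p.2} × Bool)) → ℝ) →ₗ[ℝ] ℂ) :=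
    fun q z => (LinearMap.proj q : (_ → ℝ) →ₗ[ℝ] ℝ).smulRight z
  rcases lt_trichotomy i j with h | h | h
  · refine ⟨R (Sum.inr (⟨(i, j), h⟩, false)) 1 + R (Sum.inr (⟨(i, j), h⟩, true)) Complex.I,
      fun v => ?_⟩
    apply Complex.ext <;> simp [R, tildeVecC]
  · subst h
    refine ⟨R (Sum.inl i) 1, fun v => ?_⟩
    rw [← Complex.normSq_eq_conj_mul_self, Complex.normSq_eq_norm_sq]
    simp [R, tildeVecC]
  · refine ⟨R (Sum.inr (⟨(j, i), h⟩, false)) 1 + R (Sum.inr (⟨(j, i), h⟩, true)) (-Complex.I),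
      fun v => ?_⟩
    apply Complex.ext <;> simp [R, tildeVecC] <;> ring

lemma exE {n : ℕ} (i j : Fin n) :
    ∃ T : EuclideanSpace ℂ (Fin n) →L[ℂ] EuclideanSpace ℂ (Fin n),
      ∀ v, ⟪T v, v⟫_ℂ = conj (v i) * v j := by
  refine ⟨(EuclideanSpace.proj i : EuclideanSpace ℂ (Fin n) →L[ℂ] ℂ).smulRight
    (EuclideanSpace.single j (1 : ℂ)), fun v => ?_⟩
  simp [EuclideanSpace.inner_single_left, mul_comm]

lemma exT {n : ℕ} (q : Fin n ⊕ ({p : Fin n × Fin n // p.1 < p.2} × Bool)) :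
    ∃ T : EuclideanSpace ℂ (Fin n) →L[ℂ] EuclideanSpace ℂ (Fin n),
      ∀ v, ⟪T v, v⟫_ℂ = (tildeVecC v q : ℂ) := by
  rcases q with i | ⟨⟨⟨i, j⟩, h⟩, b⟩
  · obtain ⟨T, hT⟩ := exE i i
    refine ⟨T, fun v => ?_⟩
    rw [hT, ← Complex.normSq_eq_conj_mul_self, Complex.normSq_eq_norm_sq]
    simp [tildeVecC]
  · obtain ⟨T, hT⟩ := exE i j
    obtain ⟨S, hS⟩ := exE j i
    cases b
    · refine ⟨(1 / 2 : ℂ) • (T + S), fun v => ?_⟩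
      simp only [ContinuousLinearMap.smul_apply, ContinuousLinearMap.add_apply,
        inner_smul_left, inner_add_left, hT, hS]
      apply Complex.ext <;> simp [tildeVecC] <;> ring
    · refine ⟨(⟨0, 1 / 2⟩ : ℂ) • (T - S), fun v => ?_⟩
      simp only [ContinuousLinearMap.smul_apply, ContinuousLinearMap.sub_apply,
        inner_smul_left, inner_sub_left, hT, hS]
      apply Complex.ext <;> simp [tildeVecC] <;> ring

lemma tilde_single {n : ℕ} (i : Fin n) :
    tildeVecC (EuclideanSpace.single i (1 : ℂ)) = Pi.single (Sum.inl i) 1 := by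
  ext q
  rcases q with k | ⟨⟨⟨k, l⟩, h⟩, b⟩
  · by_cases hk : k = i <;> simp [tildeVecC, Pi.single_apply, hk]
  · have h' : k < l := h
    have : ¬ (k = i ∧ l = i) := by rintro ⟨rfl, rfl⟩; exact lt_irrefl _ h'
    by_cases hk : k = i <;> by_cases hl : l = i <;> simp_all [tildeVecC, Pi.single_apply]

lemma tilde_pair {n : ℕ} (i j : Fin n) (h : i < j) (z : ℂ) (hz : ‖z‖ = 1) :
    tildeVecC (EuclideanSpace.single i (1 : ℂ) + EuclideanSpace.single j z) =
      Pi.single (Sum.inl i) 1 + Pi.single (Sum.inl j) 1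
        + z.re • Pi.single (Sum.inr (⟨(i, j), h⟩, false)) 1
        + z.im • Pi.single (Sum.inr (⟨(i, j), h⟩, true)) 1 := by
  have hij := h.ne
  have hji := h.ne'
  ext q
  rcases q with k | ⟨⟨⟨k, l⟩, hkl⟩, b⟩
  · by_cases hk : k = i
    · subst hk; simp [tildeVecC, Pi.single_apply, hij]
    · by_cases hk' : k = j
      · subst hk'; simp [tildeVecC, Pi.single_apply, hk, hz]
      · simp [tildeVecC, Pi.single_apply, hk, hk']
  · have h' : k < l := hkl
    by_cases hk : k = i
    · subst hk
      have hlk := h'.ne'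
      by_cases hl : l = j
      · subst hl
        cases b <;> simp [tildeVecC, Pi.single_apply, hij, hji]
      · cases b <;> simp [tildeVecC, Pi.single_apply, hij, hl, hlk]
    · by_cases hk' : k = j
      · subst hk'
        have h1 : l ≠ i := (h.trans h').ne'
        have h2 : l ≠ k := h'.ne'
        cases b <;> simp [tildeVecC, Pi.single_apply, hk, h1, h2]
      · cases b <;> simp [tildeVecC, Pi.single_apply, hk, hk']

lemma f_zero {n : ℕ} (f : ((Fin n ⊕ ({p : Fin n × Fin n // p.1 < p.2} × Bool)) → ℝ) →ₗ[ℝ] ℝ)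
    (hf : ∀ v : EuclideanSpace ℂ (Fin n), f (tildeVecC v) = 0) : f = 0 := by
  have h1 : ∀ i, f (Pi.single (Sum.inl i) 1) = 0 := fun i => by rw [← tilde_single, hf]
  apply LinearMap.pi_ext'
  intro q
  ext
  rcases q with i | ⟨⟨⟨i, j⟩, h⟩, b⟩
  · simpa using h1 i
  · cases b
    · have := hf (EuclideanSpace.single i (1 : ℂ) + EuclideanSpace.single j 1)
      rw [tilde_pair i j h 1 (by simp)] at this
      simpa [h1] using this
    · have := hf (EuclideanSpace.single i (1 : ℂ) + EuclideanSpace.single j Complex.I)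
      rw [tilde_pair i j h Complex.I (by simp)] at this
      simpa [h1] using this

/-- A frame `{x_k}_{k=1}^m` for `ℂⁿ` is injective if and only if
the family `{x̃_k}_{k=1}^m` spans `ℝ^{n²}`. -/
theorem stmt_4 {n m : ℕ} (x : Fin m → EuclideanSpace ℂ (Fin n))
    (hframe : ∃ A B : ℝ, 0 < A ∧ A ≤ B ∧ ∀ v : EuclideanSpace ℂ (Fin n),
      A * ‖v‖ ^ 2 ≤ ∑ k, ‖⟪v, x k⟫_ℂ‖ ^ 2 ∧ ∑ k, ‖⟪v, x k⟫_ℂ‖ ^ 2 ≤ B * ‖v‖ ^ 2) :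
    ((∀ T : EuclideanSpace ℂ (Fin n) →L[ℂ] EuclideanSpace ℂ (Fin n),
        IsSelfAdjoint T → (∀ k, ⟪T (x k), x k⟫_ℂ = 0) → T = 0) ↔
      Submodule.span ℝ (Set.range fun k => tildeVecC (x k)) = ⊤) := by
  constructor
  · intro hinj
    by_contra hne
    obtain ⟨f, hf0, hf⟩ := Submodule.exists_le_ker_of_lt_top _ (lt_top_iff_ne_top.2 hne)
    apply hf0
    choose T hT using fun q => exT (n := n) q
    have key : ∀ v, ⟪(∑ q, ((f (Pi.single q 1) : ℝ) : ℂ) • T q) v, v⟫_ℂ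
        = ((f (tildeVecC v) : ℝ) : ℂ) := by
      intro v
      rw [LinearMap.pi_apply_eq_sum_univ f (tildeVecC v)]
      simp only [ContinuousLinearMap.sum_apply, ContinuousLinearMap.smul_apply, sum_inner,
        inner_smul_left, hT, Complex.conj_ofReal]
      push_cast
      refine Finset.sum_congr rfl fun q _ => ?_
      rw [smul_eq_mul, Complex.ofReal_mul, mul_comm]
      congr 3
      ext r
      simp [Pi.single_apply, eq_comm]
    have hz := hinj (∑ q, ((f (Pi.single q 1) : ℝ) : ℂ) • T q) (by
      rw [ContinuousLinearMap.isSelfAdjoint_iff_isSymmetric,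
        LinearMap.isSymmetric_iff_inner_map_self_real]
      intro v
      have := key v
      rw [ContinuousLinearMap.coe_coe, this, Complex.conj_ofReal]) (by
      intro k
      rw [key]
      have : f (tildeVecC (x k)) = 0 := hf (Submodule.subset_span ⟨k, rfl⟩)
      rw [this, Complex.ofReal_zero])
    apply f_zero
    intro v
    have := key v
    rw [hz] at this
    simpa using this.symm
  · intro hspan T _ hT
    choose L hL using fun p : Fin n × Fin n => exL p.1 p.2
    let M := ∑ i, ∑ j, ⟪T (EuclideanSpace.single i 1), EuclideanSpace.single j 1⟫_ℂ • L (i, j)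
    have key : ∀ v, ⟪T v, v⟫_ℂ = M (tildeVecC v) := by
      intro v
      have hv : v = ∑ i, v i • EuclideanSpace.single i (1 : ℂ) := by
        ext k
        simp [Pi.single_apply]
      conv_lhs => rw [hv]
      simp only [M, map_sum, map_smul, sum_inner, inner_sum, inner_smul_left, inner_smul_right,
        LinearMap.sum_apply, LinearMap.smul_apply, hL, smul_eq_mul, Finset.mul_sum]
      rw [Finset.sum_comm]
      refine Finset.sum_congr rfl fun i _ => Finset.sum_congr rfl fun j _ => ?_
      ring
    have hM : M = 0 := by
      apply LinearMap.ext_on_range hspan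
      intro k
      rw [← key, hT]; rfl
    have : (T : EuclideanSpace ℂ (Fin n) →ₗ[ℂ] EuclideanSpace ℂ (Fin n)) = 0 := by
      rw [← inner_map_self_eq_zero]
      intro v
      rw [ContinuousLinearMap.coe_coe, key, hM]; rfl
    ext1 v
    exact LinearMap.congr_fun this v
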